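/- L^p topologies are coarser than S (Remark 4.2): Let p ∈ [1, ∞). If x_n ⇒*_S x_0 in D([0,T]), then ∫_0^T |x_n(t) − x_0(t)|^p dt → 0; consequently, the topology on D([0,T]) induced by the L^p([0,T], Lebesgue) seminorm x ↦ (∫_0^T |x(t)|^p dt)^{1/p} is coarser than the S topology. -/

import Mathlib

open MeasureTheory Filter Set Topology

noncomputable section

/-- `x` is càdlàg on `[0,T]`: right-continuous at every `t ∈ [0,T)` and
admitting a left limit at every `t ∈ (0,T]`. -/
def Cadlag (T : ℝ) (x : ℝ → ℝ) : Prop :=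
  (∀ t ∈ Set.Ico (0:ℝ) T, Filter.Tendsto x (nhdsWithin t (Set.Ioi t)) (nhds (x t))) ∧
  (∀ t ∈ Set.Ioc (0:ℝ) T, ∃ L : ℝ, Filter.Tendsto x (nhdsWithin t (Set.Iio t)) (nhds L))

/-- membership in `𝕍`: càdlàg of finite total variation on `[0,T]`. -/
def MemV (T : ℝ) (v : ℝ → ℝ) : Prop :=
  Cadlag T v ∧ BoundedVariationOn v (Set.Icc 0 T)

/-- `μ` is the finite signed (Lebesgue–Stieltjes) measure induced by `v` on `[0,T]`:
`μ([0,t]) = v(t)` for `t ∈ [0,T]`, and `μ` vanishes outside `[0,T]`. -/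
def Represents (T : ℝ) (μ : MeasureTheory.SignedMeasure ℝ) (v : ℝ → ℝ) : Prop :=
  (∀ t ∈ Set.Icc (0:ℝ) T, μ (Set.Icc 0 t) = v t) ∧
  (∀ s : Set ℝ, MeasurableSet s → s ∩ Set.Icc (0:ℝ) T = ∅ → μ s = 0)

/-- Integral of `f` against a signed measure. -/
noncomputable def sInt (μ : MeasureTheory.SignedMeasure ℝ) (f : ℝ → ℝ) : ℝ :=
  (∫ t, f t ∂μ.toJordanDecomposition.posPart) - (∫ t, f t ∂μ.toJordanDecomposition.negPart)

/-- `∫_{[0,T]} f dv` : integral of `f` with respect to the Lebesgue–Stieltjes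
signed measure induced by `v` on `[0,T]`. -/
noncomputable def intD (T : ℝ) (f v : ℝ → ℝ) : ℝ :=
  letI := Classical.propDecidable (∃ μ : MeasureTheory.SignedMeasure ℝ, Represents T μ v)
  if h : ∃ μ : MeasureTheory.SignedMeasure ℝ, Represents T μ v then sInt h.choose f else 0

/-- S-convergence `x_n →_S x₀` on `D([0,T])`. -/
def SConv (T : ℝ) (x : ℕ → ℝ → ℝ) (x₀ : ℝ → ℝ) : Prop :=
  ∀ ε > (0:ℝ), ∃ v : ℕ → ℝ → ℝ, ∃ v₀ : ℝ → ℝ,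
    (∀ n, MemV T (v n)) ∧ MemV T v₀ ∧
    (∀ n, ∀ t ∈ Set.Icc (0:ℝ) T, |x n t - v n t| ≤ ε) ∧
    (∀ t ∈ Set.Icc (0:ℝ) T, |x₀ t - v₀ t| ≤ ε) ∧
    (∀ f : ℝ → ℝ, Continuous f →
      Filter.Tendsto (fun n => intD T f (v n)) Filter.atTop (nhds (intD T f v₀)))

/-- `x_n ⇒*_S x₀` : every subsequence contains a further subsequence `→_S`-converging to `x₀`. -/
def SStarConv (T : ℝ) (x : ℕ → ℝ → ℝ) (x₀ : ℝ → ℝ) : Prop :=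
  ∀ φ : ℕ → ℕ, StrictMono φ →
    ∃ ψ : ℕ → ℕ, StrictMono ψ ∧ SConv T (fun k => x (φ (ψ k))) x₀

/-- membership in `𝔸([0,T])`: continuous, of finite variation, vanishing at `0`. -/
def MemA (T : ℝ) (A : ℝ → ℝ) : Prop :=
  ContinuousOn A (Set.Icc 0 T) ∧ BoundedVariationOn A (Set.Icc 0 T) ∧ A 0 = 0

/-- `A_n →_τ A₀` : uniform convergence on `[0,T]` together with uniformly bounded
total variations. -/
def TauConv (T : ℝ) (A : ℕ → ℝ → ℝ) (A₀ : ℝ → ℝ) : Prop :=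
  TendstoUniformlyOn (fun n => A n) A₀ Filter.atTop (Set.Icc 0 T) ∧
  ∃ M : ℝ, ∀ n, eVariationOn (A n) (Set.Icc 0 T) ≤ ENNReal.ofReal M

/-- `x` has (at least) `k` up-crossings of the levels `a < b` on `[0,T]`. -/
def HasUpcrossings (T a b : ℝ) (x : ℝ → ℝ) (k : ℕ) : Prop :=
  ∃ s u : Fin k → ℝ, (∀ i, 0 ≤ s i ∧ s i < u i ∧ u i ≤ T) ∧
    (∀ i j : Fin k, i < j → u i < s j) ∧
    (∀ i, x (s i) < a ∧ b < x (u i))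

/-- `x` has (at least) `k` `η`-oscillations on `[0,T]`. -/
def HasOscillations (T η : ℝ) (x : ℝ → ℝ) (k : ℕ) : Prop :=
  ∃ s u : Fin k → ℝ, (∀ i, 0 ≤ s i ∧ s i < u i ∧ u i ≤ T) ∧
    (∀ i j : Fin k, i < j → u i ≤ s j) ∧
    (∀ i, |x (u i) - x (s i)| > η)


/-- the Skorokhod space `D([0,T])` as a subset of `ℝ → ℝ`. -/
def Dset (T : ℝ) : Set (ℝ → ℝ) := {x | Cadlag T x}

/-- `U ⊆ D([0,T])` is `S`-open: its complement within `D([0,T])` is closed under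
`→_S`-convergence of sequences. -/
def SOpen (T : ℝ) (U : Set (ℝ → ℝ)) : Prop :=
  U ⊆ Dset T ∧
  ∀ x : ℕ → ℝ → ℝ, (∀ n, x n ∈ Dset T \ U) → ∀ x₀ ∈ Dset T, SConv T x x₀ → x₀ ∉ U

/-- Every `v ∈ 𝕍` induces a signed measure on `[0,T]`. -/
lemma MemV.exists_represents {T : ℝ} (hT : 0 < T) {v : ℝ → ℝ} (hv : MemV T v) :
    ∃ μ : SignedMeasure ℝ, Represents T μ v := by
  set c : ℝ → ℝ := fun t => max 0 (min t T) with hc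
  have hc_eq : ∀ t ∈ Icc (0:ℝ) T, c t = t := fun t ht => by simp [hc, ht.1, ht.2]
  have hbv : BoundedVariationOn (v ∘ c) univ := by
    refine ne_top_of_le_ne_top hv.2 (eVariationOn.comp_le_of_monotoneOn v c ?_ ?_)
    · exact Monotone.monotoneOn (fun a b hab => by simp only [hc]; gcongr) _
    · exact fun t _ => ⟨le_max_left _ _, max_le hT.le (min_le_right _ _)⟩
  have hleft : (v ∘ c).leftLim 0 = v 0 := by
    refine leftLim_eq_of_tendsto ?_
    refine tendsto_const_nhds.congr' ?_
    filter_upwards [self_mem_nhdsWithin] with s hs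
    have hs' : s < 0 := hs
    simp [hc, min_le_of_left_le hs'.le]
  have hright : ∀ t ∈ Icc (0:ℝ) T, (v ∘ c).rightLim t = v t := by
    intro t ht
    refine rightLim_eq_of_tendsto ?_
    rcases ht.2.lt_or_eq with h | rfl
    · refine (hv.1.1 t ⟨ht.1, h⟩).congr' ?_
      filter_upwards [Ioc_mem_nhdsGT h] with s hs
      simp [hc_eq s ⟨ht.1.trans hs.1.le, hs.2⟩]
    · refine tendsto_const_nhds.congr' ?_
      filter_upwards [self_mem_nhdsWithin] with s hs
      have hs' : t < s := hs
      simp [hc, hs'.le, ht.1]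
  refine ⟨hbv.vectorMeasure.restrict (Icc 0 T) + VectorMeasure.dirac 0 (v 0), ?_, ?_⟩
  · intro t ht
    rw [_root_.add_apply, VectorMeasure.restrict_apply _ measurableSet_Icc measurableSet_Icc,
      inter_eq_left.2 (Icc_subset_Icc_right ht.2), hbv.vectorMeasure_Icc ht.1, hleft, hright t ht,
      VectorMeasure.dirac_apply_of_mem measurableSet_Icc ⟨le_rfl, ht.1⟩]
    ring
  · intro s hs hsT
    have h0 : (0:ℝ) ∉ s := fun h => by
      have : (0:ℝ) ∈ s ∩ Icc 0 T := ⟨h, le_rfl, hT.le⟩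
      simp [hsT] at this
    rw [_root_.add_apply, VectorMeasure.restrict_apply _ measurableSet_Icc hs, hsT,
      VectorMeasure.dirac_apply_of_notMem h0]
    simp

lemma Represents.apply_Iic {T : ℝ} {μ : SignedMeasure ℝ} {v : ℝ → ℝ} (h : Represents T μ v)
    {t : ℝ} (ht : t ∈ Icc (0:ℝ) T) : μ (Iic t) = v t := by
  rw [← h.1 t ht, ← Iio_union_Icc_eq_Iic ht.1, VectorMeasure.of_union _ measurableSet_Iio
    measurableSet_Icc, h.2 (Iio 0) measurableSet_Iio, zero_add]
  · ext s; simp +contextual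
  · exact Set.disjoint_left.2 fun s hs hs' => absurd hs'.1 (not_le.2 hs)

/-- The total mass of a pair of mutually singular finite measures is controlled by the norm of the
functional `f ↦ ∫ f dP - ∫ f dN` on bounded continuous functions. -/
lemma measureReal_univ_add_le_of_integral_sub_le {P N : Measure ℝ} [IsFiniteMeasure P]
    [IsFiniteMeasure N] (hPN : P ⟂ₘ N) {C : ℝ}
    (hC : ∀ f : BoundedContinuousFunction ℝ ℝ, ‖f‖ ≤ 1 → (∫ t, f t ∂P) - ∫ t, f t ∂N ≤ C) :
    P.real univ + N.real univ ≤ C := by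
  obtain ⟨S, hS, hPS, hNS⟩ := hPN
  refine le_of_forall_pos_le_add fun ε hε => ?_
  have hε' : ENNReal.ofReal (ε / 4) ≠ 0 := by simp [hε]
  obtain ⟨A, hAS, hA, hPA⟩ := hS.compl.exists_isClosed_sdiff_lt (measure_ne_top P _) hε'
  obtain ⟨B, hBS, hB, hNB⟩ := hS.exists_isClosed_sdiff_lt (measure_ne_top N _) hε'
  have hPA' : P.real Aᶜ ≤ ε / 4 := by
    refine ENNReal.toReal_le_of_le_ofReal (by positivity) ?_
    calc P Aᶜ ≤ P (S ∪ Sᶜ \ A) := measure_mono fun x hx => by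
          by_cases h : x ∈ S
          exacts [Or.inl h, Or.inr ⟨h, hx⟩]
      _ ≤ P S + P (Sᶜ \ A) := measure_union_le _ _
      _ ≤ _ := by rw [hPS, zero_add]; exact hPA.le
  have hNB' : N.real Bᶜ ≤ ε / 4 := by
    refine ENNReal.toReal_le_of_le_ofReal (by positivity) ?_
    calc N Bᶜ ≤ N (Sᶜ ∪ S \ B) := measure_mono fun x hx => by
          by_cases h : x ∈ S
          exacts [Or.inr ⟨h, hx⟩, Or.inl h]
      _ ≤ N Sᶜ + N (S \ B) := measure_union_le _ _
      _ ≤ _ := by rw [hNS, zero_add]; exact hNB.le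
  obtain ⟨f, hfB, hfA, hf⟩ := exists_bounded_mem_Icc_of_closed_of_le hB hA
    (Set.disjoint_left.2 fun x hx hx' => hAS hx' (hBS hx)) (by norm_num : (-1:ℝ) ≤ 1)
  have hnorm : ‖f‖ ≤ 1 :=
    (BoundedContinuousFunction.norm_le zero_le_one).2 fun x => abs_le.2 (hf x)
  have hP : P.real univ - ∫ t, f t ∂P ≤ 2 * P.real Aᶜ := by
    calc P.real univ - ∫ t, f t ∂P = ∫ t, (1 - f t) ∂P := by
          rw [integral_sub (integrable_const _) (f.integrable P)]; simp
      _ ≤ ∫ t, Aᶜ.indicator (fun _ => (2:ℝ)) t ∂P := by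
          refine integral_mono ((integrable_const _).sub (f.integrable P))
            ((integrable_const _).indicator hA.measurableSet.compl) fun t => ?_
          by_cases ht : t ∈ A
          · simp [ht, hfA ht]
          · simp only [mem_compl_iff, ht, not_false_eq_true, indicator_of_mem]
            linarith [(hf t).1]
      _ = 2 * P.real Aᶜ := by
          rw [integral_indicator_const _ hA.measurableSet.compl]; simp [mul_comm]
  have hN : N.real univ + ∫ t, f t ∂N ≤ 2 * N.real Bᶜ := by
    calc N.real univ + ∫ t, f t ∂N = ∫ t, (1 + f t) ∂N := by
          rw [integral_add (integrable_const _) (f.integrable N)]; simp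
      _ ≤ ∫ t, Bᶜ.indicator (fun _ => (2:ℝ)) t ∂N := by
          refine integral_mono ((integrable_const _).add (f.integrable N))
            ((integrable_const _).indicator hB.measurableSet.compl) fun t => ?_
          by_cases ht : t ∈ B
          · simp [ht, hfB ht]
          · simp only [mem_compl_iff, ht, not_false_eq_true, indicator_of_mem]
            linarith [(hf t).2]
      _ = 2 * N.real Bᶜ := by
          rw [integral_indicator_const _ hB.measurableSet.compl]; simp [mul_comm]
  linarith [hC f hnorm]

/-- The functional `f ↦ ∫ f dμ` on bounded continuous functions. -/
def sIntCLM (μ : SignedMeasure ℝ) : BoundedContinuousFunction ℝ ℝ →L[ℝ] ℝ :=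
  LinearMap.mkContinuous
    { toFun := fun f => sInt μ f
      map_add' := fun f g => by
        simp only [sInt, BoundedContinuousFunction.coe_add, Pi.add_apply]
        rw [integral_add (f.integrable _) (g.integrable _),
          integral_add (f.integrable _) (g.integrable _)]
        ring
      map_smul' := fun c f => by
        simp only [sInt, BoundedContinuousFunction.coe_smul, smul_eq_mul,
          RingHom.id_apply, integral_const_mul]
        ring }
    (μ.toJordanDecomposition.posPart.real univ + μ.toJordanDecomposition.negPart.real univ)
    fun f => by
      have hP := f.norm_integral_le_mul_norm μ.toJordanDecomposition.posPart
      have hN := f.norm_integral_le_mul_norm μ.toJordanDecomposition.negPart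
      calc ‖sInt μ f‖ ≤ _ := norm_sub_le _ _
        _ ≤ _ := by rw [add_mul]; exact add_le_add hP hN

lemma measureReal_totalVariation_univ (μ : SignedMeasure ℝ) :
    μ.totalVariation.real univ = μ.toJordanDecomposition.posPart.real univ +
      μ.toJordanDecomposition.negPart.real univ := by
  rw [SignedMeasure.totalVariation, measureReal_add_apply]

/-- Weak-* convergent sequences of signed measures have bounded total variations. -/
lemma exists_totalVariation_le_of_tendsto {μ : ℕ → SignedMeasure ℝ} {μ₀ : SignedMeasure ℝ}
    (h : ∀ f : ℝ → ℝ, Continuous f → Tendsto (fun n => sInt (μ n) f) atTop (𝓝 (sInt μ₀ f))) :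
    ∃ K, ∀ n, (μ n).totalVariation.real univ ≤ K := by
  obtain ⟨K, hK⟩ := banach_steinhaus (g := fun n => sIntCLM (μ n)) fun f => by
    obtain ⟨C, hC⟩ := (h f f.continuous).norm.bddAbove_range
    exact ⟨C, fun n => hC (mem_range_self n)⟩
  refine ⟨K, fun n => ?_⟩
  rw [measureReal_totalVariation_univ]
  refine measureReal_univ_add_le_of_integral_sub_le
    (μ n).toJordanDecomposition.mutuallySingular fun f hf => ?_
  calc sIntCLM (μ n) f ≤ ‖sIntCLM (μ n) f‖ := le_abs_self _
    _ ≤ ‖sIntCLM (μ n)‖ * ‖f‖ := ContinuousLinearMap.le_opNorm _ _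
    _ ≤ ‖sIntCLM (μ n)‖ * 1 := by gcongr
    _ ≤ K := by rw [mul_one]; exact hK n

lemma lintegral_measure_Ioc_add (ν : Measure ℝ) [IsFiniteMeasure ν] (h : ℝ) :
    ∫⁻ t, ν (Ioc t (t + h)) = ENNReal.ofReal h * ν univ := by
  have hmeas : MeasurableSet {q : ℝ × ℝ | q.2 ∈ Ioc q.1 (q.1 + h)} :=
    (measurableSet_lt measurable_fst measurable_snd).inter
      (measurableSet_le measurable_snd (measurable_fst.add_const h))
  have hcalc := Measure.prod_apply (μ := volume) (ν := ν) hmeas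
  rw [Measure.prod_apply_symm hmeas] at hcalc
  calc ∫⁻ t, ν (Ioc t (t + h)) = ∫⁻ r, volume (Ico (r - h) r) ∂ν := by
        rw [show (∫⁻ t, ν (Ioc t (t + h))) = _ from hcalc.symm]
        refine lintegral_congr fun r => congrArg _ ?_
        ext t
        simp only [mem_preimage, mem_ofPred_eq, mem_Ioc, mem_Ico]
        constructor <;> rintro ⟨h1, h2⟩ <;> constructor <;> linarith
    _ = _ := by simp

/-- A continuous approximation of the indicator of `(-∞, t]`, decreasing linearly from `1` to `0`
on `[t, t + h]`. -/
def ramp (h t r : ℝ) : ℝ := max 0 (min 1 ((t + h - r) / h))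

lemma ramp_nonneg (h t r : ℝ) : 0 ≤ ramp h t r := le_max_left _ _

lemma ramp_le_one (h t r : ℝ) : ramp h t r ≤ 1 := max_le zero_le_one (min_le_left _ _)

lemma continuous_ramp (h : ℝ) : Continuous fun q : ℝ × ℝ => ramp h q.1 q.2 := by
  unfold ramp; fun_prop

lemma abs_ramp_sub_indicator_le {h : ℝ} (hh : 0 < h) (t r : ℝ) :
    |ramp h t r - (Iic t).indicator (fun _ => (1:ℝ)) r| ≤
      (Ioc t (t + h)).indicator (fun _ => (1:ℝ)) r := by
  rcases le_or_gt r t with hr | hr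
  · have : ramp h t r = 1 := by
      have : 1 ≤ (t + h - r) / h := by rw [le_div_iff₀ hh]; linarith
      simp [ramp, this]
    simp [this, hr]
  rcases le_or_gt r (t + h) with hr' | hr'
  · simp only [mem_Iic, not_le.2 hr, not_false_eq_true, indicator_of_notMem, sub_zero, mem_Ioc, hr,
      hr', and_self, indicator_of_mem]
    exact abs_le.2 ⟨by linarith [ramp_nonneg h t r], ramp_le_one h t r⟩
  · have : ramp h t r = 0 := by
      have : (t + h - r) / h ≤ 0 := div_nonpos_of_nonpos_of_nonneg (by linarith) hh.le
      simp [ramp, this]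
    simp [this, hr.not_ge, hr'.not_ge]

lemma integrable_ramp (ν : Measure ℝ) [IsFiniteMeasure ν] (h t : ℝ) : Integrable (ramp h t) ν :=
  Integrable.of_bound
    ((continuous_ramp h).comp (by fun_prop : Continuous fun r : ℝ => (t, r))).aestronglyMeasurable 1
    (Eventually.of_forall fun r => abs_le.2
      ⟨by linarith [ramp_nonneg h t r], ramp_le_one h t r⟩)

lemma abs_integral_ramp_sub_le (ν : Measure ℝ) [IsFiniteMeasure ν] {h : ℝ} (hh : 0 < h) (t : ℝ) :
    |(∫ r, ramp h t r ∂ν) - ν.real (Iic t)| ≤ ν.real (Ioc t (t + h)) := by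
  have hi : Integrable ((Iic t).indicator (fun _ => (1:ℝ))) ν :=
    (integrable_const _).indicator measurableSet_Iic
  calc |(∫ r, ramp h t r ∂ν) - ν.real (Iic t)|
      = |∫ r, (ramp h t r - (Iic t).indicator (fun _ => (1:ℝ)) r) ∂ν| := by
        rw [integral_sub (integrable_ramp ν h t) hi, integral_indicator_const _ measurableSet_Iic]
        simp
    _ ≤ ∫ r, |ramp h t r - (Iic t).indicator (fun _ => (1:ℝ)) r| ∂ν := abs_integral_le_integral_abs
    _ ≤ ∫ r, (Ioc t (t + h)).indicator (fun _ => (1:ℝ)) r ∂ν :=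
        integral_mono ((integrable_ramp ν h t).sub hi).abs
          ((integrable_const _).indicator measurableSet_Ioc) (abs_ramp_sub_indicator_le hh t)
    _ = _ := by rw [integral_indicator_const _ measurableSet_Ioc]; simp

lemma abs_sInt_ramp_sub_le (μ : SignedMeasure ℝ) {h : ℝ} (hh : 0 < h) (t : ℝ) :
    |sInt μ (ramp h t) - μ (Iic t)| ≤ μ.totalVariation.real (Ioc t (t + h)) := by
  have hP := abs_integral_ramp_sub_le μ.toJordanDecomposition.posPart hh t
  have hN := abs_integral_ramp_sub_le μ.toJordanDecomposition.negPart hh t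
  rw [SignedMeasure.totalVariation, measureReal_add_apply, sInt,
    μ.apply_eq_posPart_real_sub_negPart_real measurableSet_Iic]
  rw [abs_le] at *
  constructor <;> linarith [hP.1, hP.2, hN.1, hN.2]

lemma measurable_signedMeasure_Iic (μ : SignedMeasure ℝ) : Measurable fun t => μ (Iic t) := by
  have hmono : ∀ (ν : Measure ℝ) [IsFiniteMeasure ν], Monotone fun t => ν.real (Iic t) :=
    fun ν _ a b hab => measureReal_mono (Iic_subset_Iic.2 hab)
  simp_rw [fun t => μ.apply_eq_posPart_real_sub_negPart_real (measurableSet_Iic (a := t))]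
  exact (hmono _).measurable.sub (hmono _).measurable

lemma measurable_sInt_ramp (μ : SignedMeasure ℝ) (h : ℝ) :
    Measurable fun t => sInt μ (ramp h t) :=
  ((continuous_ramp h).stronglyMeasurable.integral_prod_right'.sub
    (continuous_ramp h).stronglyMeasurable.integral_prod_right').measurable

lemma abs_signedMeasure_le (μ : SignedMeasure ℝ) {s : Set ℝ} (hs : MeasurableSet s) :
    |μ s| ≤ μ.totalVariation.real univ := by
  have hP := measureReal_mono (μ := μ.toJordanDecomposition.posPart) (subset_univ s)
  have hN := measureReal_mono (μ := μ.toJordanDecomposition.negPart) (subset_univ s)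
  rw [measureReal_totalVariation_univ, μ.apply_eq_posPart_real_sub_negPart_real hs, abs_le]
  have hP' := measureReal_nonneg (μ := μ.toJordanDecomposition.posPart) (s := s)
  have hN' := measureReal_nonneg (μ := μ.toJordanDecomposition.negPart) (s := s)
  constructor <;> linarith

lemma abs_sInt_ramp_le (μ : SignedMeasure ℝ) (h t : ℝ) :
    |sInt μ (ramp h t)| ≤ μ.totalVariation.real univ := by
  have key : ∀ (ν : Measure ℝ) [IsFiniteMeasure ν],
      0 ≤ ∫ r, ramp h t r ∂ν ∧ ∫ r, ramp h t r ∂ν ≤ ν.real univ := fun ν _ =>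
    ⟨integral_nonneg (ramp_nonneg h t), by
      simpa using integral_mono (integrable_ramp ν h t) (integrable_const 1) (ramp_le_one h t)⟩
  have hP := key μ.toJordanDecomposition.posPart
  have hN := key μ.toJordanDecomposition.negPart
  rw [measureReal_totalVariation_univ, sInt, abs_le]
  constructor <;> linarith [hP.1, hP.2, hN.1, hN.2]

instance isFiniteMeasure_totalVariation (μ : SignedMeasure ℝ) :
    IsFiniteMeasure μ.totalVariation := by
  unfold SignedMeasure.totalVariation; infer_instance

lemma integrableOn_of_abs_le {T C : ℝ} {g : ℝ → ℝ} (hg : Measurable g) (hC : ∀ t, |g t| ≤ C) :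
    IntegrableOn g (Icc 0 T) :=
  Integrable.of_bound hg.aestronglyMeasurable C (Eventually.of_forall hC)

lemma integral_abs_sInt_ramp_sub_le (T : ℝ) (μ : SignedMeasure ℝ) {h : ℝ} (hh : 0 < h) :
    ∫ t in Icc (0:ℝ) T, |sInt μ (ramp h t) - μ (Iic t)| ≤ h * μ.totalVariation.real univ := by
  have hmeas : AEStronglyMeasurable (fun t => |sInt μ (ramp h t) - μ (Iic t)|)
      (volume.restrict (Icc 0 T)) :=
    ((measurable_sInt_ramp μ h).sub (measurable_signedMeasure_Iic μ)).abs.aestronglyMeasurable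
  rw [integral_eq_lintegral_of_nonneg_ae (Eventually.of_forall fun t => abs_nonneg _) hmeas]
  have : ENNReal.ofReal h * μ.totalVariation univ ≠ ⊤ :=
    ENNReal.mul_ne_top ENNReal.ofReal_ne_top (measure_ne_top _ _)
  refine (ENNReal.toReal_mono this ?_).trans_eq (by
    rw [ENNReal.toReal_mul, ENNReal.toReal_ofReal hh.le]; rfl)
  calc ∫⁻ t in Icc (0:ℝ) T, ENNReal.ofReal |sInt μ (ramp h t) - μ (Iic t)|
      ≤ ∫⁻ t, ENNReal.ofReal |sInt μ (ramp h t) - μ (Iic t)| := setLIntegral_le_lintegral _ _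
    _ ≤ ∫⁻ t, μ.totalVariation (Ioc t (t + h)) := lintegral_mono fun t =>
        ENNReal.ofReal_le_of_le_toReal (abs_sInt_ramp_sub_le μ hh t)
    _ = _ := lintegral_measure_Ioc_add _ h

/-- Weak-* convergence of signed measures implies bounded convergence in `L¹([0,T])` of their
distribution functions. -/
lemma tendsto_integral_abs_Iic_sub {T : ℝ} {μ : ℕ → SignedMeasure ℝ} {μ₀ : SignedMeasure ℝ}
    (h : ∀ f : ℝ → ℝ, Continuous f → Tendsto (fun n => sInt (μ n) f) atTop (𝓝 (sInt μ₀ f))) :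
    (∃ C, ∀ n t, |μ n (Iic t) - μ₀ (Iic t)| ≤ C) ∧
      Tendsto (fun n => ∫ t in Icc (0:ℝ) T, |μ n (Iic t) - μ₀ (Iic t)|) atTop (𝓝 0) := by
  obtain ⟨K, hK⟩ := exists_totalVariation_le_of_tendsto h
  set K₀ := μ₀.totalVariation.real univ
  have hKnn : 0 ≤ K := measureReal_nonneg.trans (hK 0)
  have hK₀nn : 0 ≤ K₀ := measureReal_nonneg
  have habs : ∀ {a b A B : ℝ}, |a| ≤ A → |b| ≤ B → |a - b| ≤ A + B := fun ha hb =>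
    (abs_sub _ _).trans (add_le_add ha hb)
  have hV : ∀ n t, |μ n (Iic t) - μ₀ (Iic t)| ≤ K + K₀ := fun n t =>
    habs ((abs_signedMeasure_le _ measurableSet_Iic).trans (hK n))
      (abs_signedMeasure_le _ measurableSet_Iic)
  refine ⟨⟨_, hV⟩, ?_⟩
  rw [Metric.tendsto_atTop]
  intro ε hε
  set δ := ε / (2 * (K + K₀ + 1)) with hδ
  have hδpos : 0 < δ := by positivity
  have hδε : δ * K + δ * K₀ < ε / 2 := by
    have : δ * (K + K₀ + 1) = ε / 2 := by rw [hδ]; field_simp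
    nlinarith
  have hsmooth : Tendsto (fun n => ∫ t in Icc (0:ℝ) T,
      |sInt (μ n) (ramp δ t) - sInt μ₀ (ramp δ t)|) atTop (𝓝 0) := by
    have := tendsto_integral_of_dominated_convergence (μ := volume.restrict (Icc (0:ℝ) T))
      (F := fun n t => |sInt (μ n) (ramp δ t) - sInt μ₀ (ramp δ t)|) (f := fun _ => 0)
      (fun _ => K + K₀)
      (fun n => ((measurable_sInt_ramp _ _).sub
        (measurable_sInt_ramp _ _)).abs.aestronglyMeasurable)
      (integrable_const _)
      (fun n => Eventually.of_forall fun t => by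
        rw [Real.norm_eq_abs, abs_abs]
        exact habs ((abs_sInt_ramp_le _ _ _).trans (hK n)) (abs_sInt_ramp_le _ _ _))
      (Eventually.of_forall fun t => by
        have hc : Continuous (ramp δ t) :=
          (continuous_ramp δ).comp (by fun_prop : Continuous fun r : ℝ => (t, r))
        simpa using ((h _ hc).sub_const (sInt μ₀ (ramp δ t))).abs)
    simpa using this
  obtain ⟨M, hM⟩ := eventually_atTop.1 (hsmooth.eventually (gt_mem_nhds (half_pos hε)))
  refine ⟨M, fun n hn => ?_⟩
  rw [Real.dist_eq, sub_zero, abs_of_nonneg (integral_nonneg fun t => abs_nonneg _)]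
  have hint : ∀ ν : SignedMeasure ℝ,
      IntegrableOn (fun t => |sInt ν (ramp δ t) - ν (Iic t)|) (Icc 0 T) := fun ν =>
    integrableOn_of_abs_le
      ((measurable_sInt_ramp _ _).sub (measurable_signedMeasure_Iic _)).abs
      (fun t => by
        rw [abs_abs]
        exact habs (abs_sInt_ramp_le _ _ _) (abs_signedMeasure_le _ measurableSet_Iic))
  have hints : IntegrableOn (fun t => |sInt (μ n) (ramp δ t) - sInt μ₀ (ramp δ t)|) (Icc 0 T) :=
    integrableOn_of_abs_le ((measurable_sInt_ramp _ _).sub (measurable_sInt_ramp _ _)).abs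
      (fun t => by
        rw [abs_abs]
        exact habs (abs_sInt_ramp_le _ _ _) (abs_sInt_ramp_le _ _ _))
  calc ∫ t in Icc (0:ℝ) T, |μ n (Iic t) - μ₀ (Iic t)|
      ≤ ∫ t in Icc (0:ℝ) T, (|sInt (μ n) (ramp δ t) - μ n (Iic t)| +
          |sInt μ₀ (ramp δ t) - μ₀ (Iic t)| +
          |sInt (μ n) (ramp δ t) - sInt μ₀ (ramp δ t)|) := by
        refine integral_mono_of_nonneg (Eventually.of_forall fun t => abs_nonneg _)
          (((hint _).add (hint _)).add hints) (Eventually.of_forall fun t => ?_)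
        have h1 := abs_le.1 (le_refl |sInt (μ n) (ramp δ t) - μ n (Iic t)|)
        have h2 := abs_le.1 (le_refl |sInt μ₀ (ramp δ t) - μ₀ (Iic t)|)
        have h3 := abs_le.1 (le_refl |sInt (μ n) (ramp δ t) - sInt μ₀ (ramp δ t)|)
        exact abs_le.2 ⟨by linarith [h1.1, h1.2, h2.1, h2.2, h3.1, h3.2],
          by linarith [h1.1, h1.2, h2.1, h2.2, h3.1, h3.2]⟩
    _ = (∫ t in Icc (0:ℝ) T, |sInt (μ n) (ramp δ t) - μ n (Iic t)|) +
          (∫ t in Icc (0:ℝ) T, |sInt μ₀ (ramp δ t) - μ₀ (Iic t)|) +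
          ∫ t in Icc (0:ℝ) T, |sInt (μ n) (ramp δ t) - sInt μ₀ (ramp δ t)| := by
        rw [← integral_add (hint _) (hint _), ← integral_add _ hints]
        exact (hint _).add (hint _)
    _ < ε := by
        have h1 := integral_abs_sInt_ramp_sub_le T (μ n) hδpos
        have h2 := integral_abs_sInt_ramp_sub_le T μ₀ hδpos
        have h3 := mul_le_mul_of_nonneg_left (hK n) hδpos.le
        linarith [hM n hn]

lemma rpow_le_of_le_add {p : ℝ} (hp : 1 ≤ p) {a b d C : ℝ} (ha : 0 ≤ a) (hb : 0 ≤ b) (hd : 0 ≤ d)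
    (hdC : d ≤ C) (h : a ≤ b + d) : a ^ p ≤ (2 * b) ^ p + (2 * C) ^ (p - 1) * 2 * d := by
  have hp0 : 0 ≤ p := by linarith
  have hC : 0 ≤ C := hd.trans hdC
  rcases le_total d b with hdb | hbd
  · have : a ^ p ≤ (2 * b) ^ p := by gcongr; linarith
    have : 0 ≤ (2 * C) ^ (p - 1) * 2 * d := by positivity
    linarith
  · have h1 : a ^ p ≤ (2 * d) ^ p := by gcongr; linarith
    have h2 : (2 * d) ^ p = (2 * d) ^ (p - 1) * (2 * d) := by
      rcases hd.eq_or_lt with rfl | hd'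
      · simp [Real.zero_rpow (by linarith : p ≠ 0)]
      · rw [← Real.rpow_add_one (by positivity)]; simp
    have h3 : (2 * d) ^ (p - 1) * (2 * d) ≤ (2 * C) ^ (p - 1) * (2 * d) := by
      gcongr
    have : 0 ≤ (2 * b) ^ p := by positivity
    linarith

/-- S-convergence implies convergence in `L^p([0,T])`. -/
lemma SConv.tendsto_integral_rpow {T : ℝ} (hT : 0 < T) {p : ℝ} (hp : 1 ≤ p) {x : ℕ → ℝ → ℝ}
    {x₀ : ℝ → ℝ} (hx : SConv T x x₀) :
    Tendsto (fun n => ∫ t in Icc (0:ℝ) T, |x n t - x₀ t| ^ p) atTop (𝓝 0) := by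
  have hnn : ∀ n, 0 ≤ ∫ t in Icc (0:ℝ) T, |x n t - x₀ t| ^ p := fun n =>
    integral_nonneg fun t => by positivity
  rw [Metric.tendsto_atTop]
  intro η hη
  obtain ⟨ε, hεη, hε⟩ : ∃ ε : ℝ, T * (2 * (2 * ε)) ^ p < η / 2 ∧ 0 < ε := by
    have hcont : Continuous fun ε : ℝ => T * (2 * (2 * ε)) ^ p :=
      continuous_const.mul ((by fun_prop : Continuous fun ε : ℝ => 2 * (2 * ε)).rpow_const
        fun _ => Or.inr (by linarith))
    have h0 : Tendsto (fun ε : ℝ => T * (2 * (2 * ε)) ^ p) (𝓝[>] 0) (𝓝 0) := by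
      have := (hcont.tendsto 0).mono_left (nhdsWithin_le_nhds (s := Ioi 0))
      simpa [Real.zero_rpow (by linarith : p ≠ 0)] using this
    exact ((h0.eventually (gt_mem_nhds (half_pos hη))).and self_mem_nhdsWithin).exists
  obtain ⟨v, v₀, hv, hv₀, hxv, hxv₀, hconv⟩ := hx ε hε
  have hrep : ∀ w, MemV T w →
      ∃ μ : SignedMeasure ℝ, Represents T μ w ∧ ∀ f, intD T f w = sInt μ f := fun w hw =>
    ⟨_, (hw.exists_represents hT).choose_spec, fun f => dif_pos (hw.exists_represents hT)⟩
  choose μ hμ hμint using fun n => hrep (v n) (hv n)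
  obtain ⟨μ₀, hμ₀, hμ₀int⟩ := hrep v₀ hv₀
  simp only [hμint, hμ₀int] at hconv
  obtain ⟨⟨C, hC⟩, hlim⟩ := tendsto_integral_abs_Iic_sub (T := T) hconv
  have hlim' := hlim.const_mul ((2 * C) ^ (p - 1) * 2)
  rw [mul_zero] at hlim'
  obtain ⟨M, hM⟩ := eventually_atTop.1 (hlim'.eventually (gt_mem_nhds (half_pos hη)))
  refine ⟨M, fun n hn => ?_⟩
  rw [Real.dist_eq, sub_zero, abs_of_nonneg (hnn n)]
  have hint : IntegrableOn (fun t => |μ n (Iic t) - μ₀ (Iic t)|) (Icc 0 T) :=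
    integrableOn_of_abs_le
      ((measurable_signedMeasure_Iic _).sub (measurable_signedMeasure_Iic _)).abs
      (fun t => by rw [abs_abs]; exact hC n t)
  calc ∫ t in Icc (0:ℝ) T, |x n t - x₀ t| ^ p
      ≤ ∫ t in Icc (0:ℝ) T,
          ((2 * (2 * ε)) ^ p + (2 * C) ^ (p - 1) * 2 * |μ n (Iic t) - μ₀ (Iic t)|) := by
        refine integral_mono_of_nonneg (Eventually.of_forall fun t => by positivity)
          ((integrable_const _).add (hint.const_mul _)) ?_
        filter_upwards [ae_restrict_mem measurableSet_Icc] with t ht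
        refine rpow_le_of_le_add hp (abs_nonneg _) (by positivity) (abs_nonneg _) (hC n t) ?_
        rw [(hμ n).apply_Iic ht, hμ₀.apply_Iic ht]
        have h1 := abs_le.1 (hxv n t ht)
        have h2 := abs_le.1 (hxv₀ t ht)
        have h3 := abs_le.1 (le_refl |v n t - v₀ t|)
        exact abs_le.2 ⟨by linarith [h1.1, h1.2, h2.1, h2.2, h3.1, h3.2],
          by linarith [h1.1, h1.2, h2.1, h2.2, h3.1, h3.2]⟩
    _ = T * (2 * (2 * ε)) ^ p +
          (2 * C) ^ (p - 1) * 2 * ∫ t in Icc (0:ℝ) T, |μ n (Iic t) - μ₀ (Iic t)| := by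
        rw [integral_add (integrable_const _) (hint.const_mul _), integral_const_mul]
        simp [hT.le]
    _ < η := by linarith [hM n hn]

/-- Remark 4.2: the `L^p([0,T])` topologies are coarser than `S`. -/
theorem stmt6 (T : ℝ) (hT : 0 < T) (p : ℝ) (hp : 1 ≤ p) :
    (∀ x : ℕ → ℝ → ℝ, ∀ x₀ : ℝ → ℝ, (∀ n, Cadlag T (x n)) → Cadlag T x₀ →
      SStarConv T x x₀ →
      Filter.Tendsto (fun n => ∫ t in Set.Icc (0:ℝ) T, |x n t - x₀ t| ^ p)
        Filter.atTop (nhds 0)) ∧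
    (∀ U : Set (ℝ → ℝ), U ⊆ Dset T →
      (∀ x₀ ∈ U, ∃ δ > (0:ℝ), ∀ y ∈ Dset T,
        (∫ t in Set.Icc (0:ℝ) T, |y t - x₀ t| ^ p) < δ → y ∈ U) →
      SOpen T U) := by
  refine ⟨fun x x₀ _ _ hx => ?_, fun U hU hopen => ⟨hU, fun x hxU x₀ _ hx hx₀ => ?_⟩⟩
  · refine tendsto_of_subseq_tendsto fun ns hns => ?_
    obtain ⟨φ, -, hφ⟩ := strictMono_subseq_of_tendsto_atTop hns
    obtain ⟨ψ, -, hψ⟩ := hx _ hφ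
    exact ⟨fun k => φ (ψ k), hψ.tendsto_integral_rpow hT hp⟩
  · obtain ⟨δ, hδ, hball⟩ := hopen x₀ hx₀
    obtain ⟨n, hn⟩ :=
      ((hx.tendsto_integral_rpow hT hp).eventually (gt_mem_nhds hδ)).exists
    exact (hxU n).2 (hball _ (hxU n).1 hn)

end
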